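/- arXiv:2412.17358 — 5 statements merged into one kernel-verified Lean document; each statement's English description precedes it below -/
import Mathlib

section
/- Let μ ∈ ℝ³, let Σ be a 3×3 real symmetric positive semidefinite matrix, let E be a 3×3 real symmetric positive definite matrix, let ε ∈ (0,1), and define the safety cost l(r) = (r-μ)ᵀ E (r-μ) - 1 for r ∈ ℝ³. Then the supremum, over all Borel probability measures P on ℝ³ with finite second moments, mean ∫ r dP(r) = μ and covariance ∫ (r-μ)(r-μ)ᵀ dP(r) = Σ, of CVaR_ε^P(l(r)) equals -1 + (1/ε)·Tr(ΣE). -/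
open MeasureTheory Matrix

/-- Conditional Value-at-Risk of a real random variable `X` under measure `P` at level `ε`:
`CVaR_ε^P(X) = inf_{β ∈ ℝ} { β + (1/ε) E_P[max(X - β, 0)] }`. -/
noncomputable def CVaR {Ω : Type*} [MeasurableSpace Ω] (P : Measure Ω) (X : Ω → ℝ) (ε : ℝ) : ℝ :=
  ⨅ β : ℝ, β + ε⁻¹ * ∫ ω, max (X ω - β) 0 ∂P

lemma wc_integrable (μ : Fin 3 → ℝ) (P : Measure (Fin 3 → ℝ)) [IsProbabilityMeasure P]
    (h2 : Integrable (fun r => ‖r‖ ^ 2) P) (i j : Fin 3) :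
    Integrable (fun r : Fin 3 → ℝ => (r i - μ i) * (r j - μ j)) P := by
  have hg : Integrable (fun r : Fin 3 → ℝ => 2 * ‖r‖ ^ 2 + 2 * ‖μ‖ ^ 2) P :=
    (h2.const_mul 2).add (integrable_const _)
  refine hg.mono' (by fun_prop) (Filter.Eventually.of_forall fun r => ?_)
  have hi := norm_le_pi_norm (r - μ) i
  have hj := norm_le_pi_norm (r - μ) j
  have hs := norm_sub_le r μ
  simp only [Pi.sub_apply] at hi hj
  rw [norm_mul]
  have h1 : ‖r i - μ i‖ * ‖r j - μ j‖ ≤ (‖r‖ + ‖μ‖) * (‖r‖ + ‖μ‖) := by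
    apply mul_le_mul (hi.trans hs) (hj.trans hs) (norm_nonneg _) (by positivity)
  nlinarith [sq_nonneg (‖r‖ - ‖μ‖)]

lemma wc_quad (v : Fin 3 → ℝ) (E : Matrix (Fin 3) (Fin 3) ℝ) :
    dotProduct v (E.mulVec v) = ∑ i, ∑ j, E j i * (v i * v j) := by
  simp only [dotProduct, mulVec, Fin.sum_univ_three]
  ring

lemma wc_int (μ : Fin 3 → ℝ) (E : Matrix (Fin 3) (Fin 3) ℝ)
    (P : Measure (Fin 3 → ℝ)) [IsProbabilityMeasure P]
    (h2 : Integrable (fun r => ‖r‖ ^ 2) P) :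
    Integrable (fun r => dotProduct (r - μ) (E.mulVec (r - μ))) P := by
  simp only [wc_quad, Pi.sub_apply]
  exact integrable_finsetSum _ fun i _ => integrable_finsetSum _ fun j _ =>
    (wc_integrable μ P h2 i j).const_mul _

lemma wc_mean (μ : Fin 3 → ℝ) (S E : Matrix (Fin 3) (Fin 3) ℝ)
    (P : Measure (Fin 3 → ℝ)) [IsProbabilityMeasure P]
    (h2 : Integrable (fun r => ‖r‖ ^ 2) P)
    (hS : ∀ i j, S i j = ∫ r, (r i - μ i) * (r j - μ j) ∂P) :
    ∫ r, dotProduct (r - μ) (E.mulVec (r - μ)) ∂P = (S * E).trace := by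
  simp only [wc_quad, Pi.sub_apply]
  rw [integral_finsetSum _ fun i _ => integrable_finsetSum _ fun j _ =>
    (wc_integrable μ P h2 i j).const_mul _]
  simp only [Matrix.trace, Matrix.diag, Matrix.mul_apply]
  refine Finset.sum_congr rfl fun i _ => ?_
  rw [integral_finsetSum _ fun j _ => (wc_integrable μ P h2 i j).const_mul _]
  refine Finset.sum_congr rfl fun j _ => ?_
  rw [integral_const_mul, ← hS, mul_comm]

lemma wc_upper (μ : Fin 3 → ℝ) (S E : Matrix (Fin 3) (Fin 3) ℝ)
    (hE : E.PosDef) (ε : ℝ) (hε : ε ∈ Set.Ioo (0 : ℝ) 1)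
    (P : Measure (Fin 3 → ℝ)) [IsProbabilityMeasure P]
    (h2 : Integrable (fun r => ‖r‖ ^ 2) P)
    (hS : ∀ i j, S i j = ∫ r, (r i - μ i) * (r j - μ j) ∂P) :
    CVaR P (fun r => dotProduct (r - μ) (E.mulVec (r - μ)) - 1) ε
      ≤ -1 + ε⁻¹ * (S * E).trace := by
  have hint := wc_int μ E P h2
  have hX : Integrable (fun r => dotProduct (r - μ) (E.mulVec (r - μ)) - 1) P :=
    hint.sub (integrable_const _)
  have hε1 : 1 ≤ ε⁻¹ := (one_le_inv₀ hε.1).2 hε.2.le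
  unfold CVaR
  have hb : BddBelow (Set.range fun β : ℝ => β + ε⁻¹ *
      ∫ r, max (dotProduct (r - μ) (E.mulVec (r - μ)) - 1 - β) 0 ∂P) := by
    refine ⟨∫ r, (dotProduct (r - μ) (E.mulVec (r - μ)) - 1) ∂P, ?_⟩
    rintro _ ⟨β, rfl⟩
    have hXb : Integrable (fun r => dotProduct (r - μ) (E.mulVec (r - μ)) - 1 - β) P :=
      hX.sub (integrable_const _)
    have h0 : 0 ≤ ∫ r, max (dotProduct (r - μ) (E.mulVec (r - μ)) - 1 - β) 0 ∂P :=
      integral_nonneg fun r => le_max_right _ _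
    have h1 : ∫ r, (dotProduct (r - μ) (E.mulVec (r - μ)) - 1 - β) ∂P ≤
        ∫ r, max (dotProduct (r - μ) (E.mulVec (r - μ)) - 1 - β) 0 ∂P :=
      integral_mono hXb hXb.pos_part fun r => le_max_left _ _
    rw [integral_sub hX (integrable_const _)] at h1
    simp only [integral_const, probReal_univ, one_smul] at h1
    dsimp only
    nlinarith
  refine (ciInf_le hb (-1)).trans (le_of_eq ?_)
  rw [← wc_mean μ S E P h2 hS]
  congr 2
  refine integral_congr_ae (Filter.Eventually.of_forall fun r => ?_)
  have := hE.posSemidef.dotProduct_mulVec_nonneg (r - μ)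
  simp only [star_trivial] at this
  have e : (r - μ) ⬝ᵥ (E *ᵥ (r - μ)) - 1 - -1 = (r - μ) ⬝ᵥ (E *ᵥ (r - μ)) := by ring
  simp only [e]
  exact max_eq_left this

/-- The extremal distribution. -/
noncomputable def wcP (μ : Fin 3 → ℝ) (ε : ℝ) (w : Fin 3 → Fin 3 → ℝ) : Measure (Fin 3 → ℝ) :=
  ENNReal.ofReal (1 - ε) • Measure.dirac μ +
    ∑ k, ENNReal.ofReal (ε / 6) • (Measure.dirac (μ + w k) + Measure.dirac (μ - w k))

lemma wcP_integrable {F : Type*} [NormedAddCommGroup F] (μ : Fin 3 → ℝ) (ε : ℝ)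
    (w : Fin 3 → Fin 3 → ℝ) (f : (Fin 3 → ℝ) → F) : Integrable f (wcP μ ε w) := by
  have hd : ∀ a, Integrable f (Measure.dirac a) := fun a => integrable_dirac (by simp)
  refine ((hd _).smul_measure ENNReal.ofReal_ne_top).add_measure ?_
  exact integrable_finsetSum_measure.2 fun k _ =>
    ((hd _).add_measure (hd _)).smul_measure ENNReal.ofReal_ne_top

lemma wcP_integral {F : Type*} [NormedAddCommGroup F] [NormedSpace ℝ F] [CompleteSpace F]
    (μ : Fin 3 → ℝ) (ε : ℝ) (hε : ε ∈ Set.Ioo (0 : ℝ) 1)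
    (w : Fin 3 → Fin 3 → ℝ) (f : (Fin 3 → ℝ) → F) :
    ∫ r, f r ∂(wcP μ ε w) = (1 - ε) • f μ + ∑ k, (ε / 6) • (f (μ + w k) + f (μ - w k)) := by
  have hd : ∀ a, Integrable f (Measure.dirac a) := fun a => integrable_dirac (by simp)
  have hd2 : ∀ k, Integrable f (ENNReal.ofReal (ε / 6) •
      (Measure.dirac (μ + w k) + Measure.dirac (μ - w k))) := fun k =>
    ((hd _).add_measure (hd _)).smul_measure ENNReal.ofReal_ne_top
  have e1 : 0 ≤ 1 - ε := by linarith [hε.2]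
  have e2 : 0 ≤ ε / 6 := by linarith [hε.1]
  unfold wcP
  rw [integral_add_measure ((hd _).smul_measure ENNReal.ofReal_ne_top)
    (integrable_finsetSum_measure.2 fun k _ => hd2 k),
    integral_finsetSum_measure fun k _ => hd2 k]
  simp only [integral_smul_measure, integral_dirac, ENNReal.toReal_ofReal e1,
    ENNReal.toReal_ofReal e2, integral_add_measure (hd _) (hd _)]

lemma wcP_prob (μ : Fin 3 → ℝ) (ε : ℝ) (hε : ε ∈ Set.Ioo (0 : ℝ) 1)
    (w : Fin 3 → Fin 3 → ℝ) : IsProbabilityMeasure (wcP μ ε w) := by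
  have e1 : 0 ≤ 1 - ε := by linarith [hε.2]
  have e2 : 0 ≤ ε / 6 := by linarith [hε.1]
  constructor
  simp only [wcP, Measure.add_apply, Measure.smul_apply, measure_univ,
    Fin.sum_univ_three, smul_eq_mul, mul_one, mul_add]
  rw [← ENNReal.ofReal_add, ← ENNReal.ofReal_add, ← ENNReal.ofReal_add, ← ENNReal.ofReal_add,
    ← ENNReal.ofReal_one]
  · congr 1; ring
  all_goals positivity

open scoped ComplexOrder MatrixOrder Matrix.Norms.L2Operator in
lemma wc_sqrt (S : Matrix (Fin 3) (Fin 3) ℝ) (hS : S.PosSemidef) :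
    ∃ B : Matrix (Fin 3) (Fin 3) ℝ, S = Bᴴ * B :=
  CStarAlgebra.nonneg_iff_eq_star_mul_self.mp hS.nonneg

/-- The worst-case CVaR of the safety cost `l(r) = (r-μ)ᵀ E (r-μ) - 1` over all Borel
probability measures on ℝ³ with finite second moments, mean `μ` and covariance `S`
equals `-1 + (1/ε)·Tr(S·E)`. -/
theorem worst_case_CVaR_eq (μ : Fin 3 → ℝ) (S E : Matrix (Fin 3) (Fin 3) ℝ)
    (hS : S.PosSemidef) (hE : E.PosDef) (ε : ℝ) (hε : ε ∈ Set.Ioo (0 : ℝ) 1) :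
    sSup {c : ℝ | ∃ P : Measure (Fin 3 → ℝ), IsProbabilityMeasure P ∧
        Integrable (fun r => ‖r‖ ^ 2) P ∧
        (∫ r, r ∂P) = μ ∧
        (∀ i j, S i j = ∫ r, (r i - μ i) * (r j - μ j) ∂P) ∧
        c = CVaR P (fun r => dotProduct (r - μ) (E.mulVec (r - μ)) - 1) ε} =
      -1 + ε⁻¹ * (S * E).trace := by
  refine IsGreatest.csSup_eq ⟨?_, ?_⟩
  · obtain ⟨B, hB⟩ : ∃ B : Matrix (Fin 3) (Fin 3) ℝ, S = Bᴴ * B := by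
      exact wc_sqrt S hS
    have hpos := hε.1
    have hc : Real.sqrt (3 / ε) ^ 2 = 3 / ε := Real.sq_sqrt (by positivity)
    set c := Real.sqrt (3 / ε) with hcdef
    set w : Fin 3 → Fin 3 → ℝ := fun k i => c * B k i with hw
    have hP := wcP_prob μ ε hε w
    have hcov : ∀ i j, S i j = ∫ r, (r i - μ i) * (r j - μ j) ∂(wcP μ ε w) := by
      intro i j
      rw [wcP_integral μ ε hε, hB]
      simp only [Matrix.mul_apply, conjTranspose_apply, star_trivial, smul_eq_mul, sub_self,
        mul_zero, zero_add, Pi.add_apply, Pi.sub_apply, hw]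
      refine Finset.sum_congr rfl fun k _ => ?_
      have : ε * c ^ 2 = 3 := by rw [hc]; field_simp
      linear_combination (-(B k i * B k j) / 3) * this
    have h2 : Integrable (fun r => ‖r‖ ^ 2) (wcP μ ε w) := wcP_integrable _ _ _ _
    refine ⟨wcP μ ε w, hP, h2, ?_, hcov, ?_⟩
    · rw [wcP_integral μ ε hε]
      ext i
      simp
      ring
    · refine le_antisymm ?_ (wc_upper μ S E hE ε hε _ h2 hcov)
      refine le_ciInf fun β => ?_
      have hm := wc_mean μ S E _ h2 hcov
      rw [wcP_integral μ ε hε] at hm ⊢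
      simp only [sub_self, zero_dotProduct, smul_eq_mul, mul_zero, zero_add] at hm ⊢
      have key : (S * E).trace - ε * (1 + β) ≤ (1 - ε) * max (0 - 1 - β) 0 +
          ∑ k, ε / 6 * (max ((μ + w k - μ) ⬝ᵥ (E *ᵥ (μ + w k - μ)) - 1 - β) 0 +
            max ((μ - w k - μ) ⬝ᵥ (E *ᵥ (μ - w k - μ)) - 1 - β) 0) := by
        have h0 : 0 ≤ (1 - ε) * max (0 - 1 - β) 0 :=
          mul_nonneg (by linarith [hε.2]) (le_max_right _ _)
        have h1 : ∑ k, ε / 6 * (((μ + w k - μ) ⬝ᵥ (E *ᵥ (μ + w k - μ)) - 1 - β) +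
            ((μ - w k - μ) ⬝ᵥ (E *ᵥ (μ - w k - μ)) - 1 - β)) ≤
          ∑ k, ε / 6 * (max ((μ + w k - μ) ⬝ᵥ (E *ᵥ (μ + w k - μ)) - 1 - β) 0 +
            max ((μ - w k - μ) ⬝ᵥ (E *ᵥ (μ - w k - μ)) - 1 - β) 0) := by
          refine Finset.sum_le_sum fun k _ => mul_le_mul_of_nonneg_left ?_ (by positivity)
          exact add_le_add (le_max_left _ _) (le_max_left _ _)
        have h3 : ∑ k, ε / 6 * (((μ + w k - μ) ⬝ᵥ (E *ᵥ (μ + w k - μ)) - 1 - β) +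
            ((μ - w k - μ) ⬝ᵥ (E *ᵥ (μ - w k - μ)) - 1 - β)) = (S * E).trace - ε * (1 + β) := by
          rw [← hm]
          simp only [Fin.sum_univ_three]
          ring
        rw [h3] at h1
        exact h1.trans (le_add_of_nonneg_left h0)
      have := mul_le_mul_of_nonneg_left key (inv_nonneg.2 hpos.le)
      have e : ε⁻¹ * ((S * E).trace - ε * (1 + β)) = ε⁻¹ * (S * E).trace - (1 + β) := by
        field_simp
      linarith
  · rintro _ ⟨P, hP, h2, -, hcov, rfl⟩
    exact wc_upper μ S E hE ε hε P h2 hcov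
end

section
/- Let μ ∈ ℝ³, let E be a 3×3 real symmetric positive definite matrix, let ε ∈ (0,1), and define l(r) = (r-μ)ᵀ E (r-μ) - 1. For every Borel probability measure P on ℝ³ with finite second moments, mean ∫ r dP(r) = μ and covariance ∫ (r-μ)(r-μ)ᵀ dP(r) = Σ, one has CVaR_ε^P(l(r)) ≤ -1 + (1/ε)·Tr(ΣE). -/
open MeasureTheory Matrix

/-- For every Borel probability measure `P` on ℝ³ with finite second moments, mean `μ` and
covariance `S`, the CVaR of the safety cost `l(r) = (r-μ)ᵀ E (r-μ) - 1` is bounded above by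
`-1 + (1/ε)·Tr(S·E)`. -/
theorem CVaR_le_closed_form (μ : Fin 3 → ℝ) (E : Matrix (Fin 3) (Fin 3) ℝ)
    (hE : E.PosDef) (ε : ℝ) (hε : ε ∈ Set.Ioo (0 : ℝ) 1)
    (P : Measure (Fin 3 → ℝ)) [IsProbabilityMeasure P]
    (S : Matrix (Fin 3) (Fin 3) ℝ)
    (h2 : Integrable (fun r => ‖r‖ ^ 2) P)
    (hmean : (∫ r, r ∂P) = μ)
    (hcov : ∀ i j, S i j = ∫ r, (r i - μ i) * (r j - μ j) ∂P) :
    CVaR P (fun r => dotProduct (r - μ) (E.mulVec (r - μ)) - 1) ε ≤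
      -1 + ε⁻¹ * (S * E).trace := by
  obtain ⟨hε0, hε1⟩ := hε
  have hid : MemLp (fun r : Fin 3 → ℝ => r) 2 P :=
    (memLp_two_iff_integrable_sq_norm (by fun_prop)).2 h2
  have hc : ∀ i, MemLp (fun r : Fin 3 → ℝ => r i - μ i) 2 P := by
    intro i
    have h1 : MemLp (fun r : Fin 3 → ℝ => r i) 2 P :=
      hid.mono (measurable_pi_apply i).aestronglyMeasurable (Filter.Eventually.of_forall fun r => norm_le_pi_norm r i)
    exact h1.sub (memLp_const (μ i))
  have hp : ∀ i j, Integrable (fun r : Fin 3 → ℝ => (r i - μ i) * (r j - μ j)) P :=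
    fun i j => (hc i).integrable_mul (hc j)
  have hexp : ∀ r : Fin 3 → ℝ, dotProduct (r - μ) (E.mulVec (r - μ)) =
      ∑ i, ∑ j, E i j * ((r i - μ i) * (r j - μ j)) := by
    intro r
    simp only [dotProduct, mulVec, Finset.mul_sum, Pi.sub_apply]
    refine Finset.sum_congr rfl fun i _ => Finset.sum_congr rfl fun j _ => by ring
  have hnn : ∀ r : Fin 3 → ℝ, 0 ≤ dotProduct (r - μ) (E.mulVec (r - μ)) := by
    intro r
    simpa using hE.posSemidef.dotProduct_mulVec_nonneg (r - μ)
  have hq : Integrable (fun r : Fin 3 → ℝ => dotProduct (r - μ) (E.mulVec (r - μ))) P := by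
    simp only [hexp]
    exact integrable_finsetSum _ fun i _ => integrable_finsetSum _ fun j _ =>
      (hp i j).const_mul _
  have hint : ∫ r, dotProduct (r - μ) (E.mulVec (r - μ)) ∂P = (S * E).trace := by
    simp only [hexp]
    rw [integral_finsetSum Finset.univ (fun i _ => integrable_finsetSum Finset.univ
      (fun j _ => (hp i j).const_mul (E i j)))]
    rw [trace_mul_comm]
    simp only [Matrix.trace, Matrix.diag, Matrix.mul_apply]
    refine Finset.sum_congr rfl fun i _ => ?_
    rw [integral_finsetSum Finset.univ (fun j _ => (hp i j).const_mul (E i j))]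
    refine Finset.sum_congr rfl fun j _ => ?_
    rw [integral_const_mul, hcov j i]
    simp only [mul_comm]
  have hinv : 1 ≤ ε⁻¹ := (one_le_inv₀ hε0).2 hε1.le
  unfold CVaR
  have hb : BddBelow (Set.range fun β : ℝ => β + ε⁻¹ *
      ∫ r, max (dotProduct (r - μ) (E.mulVec (r - μ)) - 1 - β) 0 ∂P) := by
    refine ⟨-1, ?_⟩
    rintro _ ⟨β, rfl⟩
    have hm : Integrable (fun r : Fin 3 → ℝ =>
        max (dotProduct (r - μ) (E.mulVec (r - μ)) - 1 - β) 0) P :=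
      ((hq.sub (integrable_const 1)).sub (integrable_const β)).pos_part
    have h0 : 0 ≤ ∫ r, max (dotProduct (r - μ) (E.mulVec (r - μ)) - 1 - β) 0 ∂P :=
      integral_nonneg fun r => le_max_right _ _
    have h1 : -1 - β ≤ ∫ r, max (dotProduct (r - μ) (E.mulVec (r - μ)) - 1 - β) 0 ∂P := by
      have := integral_mono (integrable_const (-1 - β)) hm
        (fun r => le_trans (by linarith [hnn r]) (le_max_left _ _))
      simpa using this
    have := mul_le_mul_of_nonneg_right hinv h0
    simp only
    linarith
  refine (ciInf_le hb (-1)).trans (le_of_eq ?_)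
  rw [← hint]
  congr 2
  refine integral_congr_ae (Filter.Eventually.of_forall fun r => ?_)
  simp only
  rw [max_eq_left (by linarith [hnn r])]
  ring
end

section
/- Let μ ∈ ℝ³, let Σ be a 3×3 real symmetric positive semidefinite matrix, let E be a 3×3 real symmetric positive definite matrix, let ε ∈ (0,1), and define l(r) = (r-μ)ᵀ E (r-μ) - 1. Then there exists a Borel probability measure P on ℝ³ with finite second moments, mean ∫ r dP(r) = μ and covariance ∫ (r-μ)(r-μ)ᵀ dP(r) = Σ, such that CVaR_ε^P(l(r)) = -1 + (1/ε)·Tr(ΣE); that is, the worst-case CVaR over the moment-based ambiguity set is attained. -/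
open MeasureTheory Matrix

open scoped MatrixOrder

lemma aux_integrable {ι : Type} [Fintype ι] (w : ι → ℝ) (x : ι → Fin 3 → ℝ)
    {F : Type*} [NormedAddCommGroup F] (f : (Fin 3 → ℝ) → F) :
    Integrable f (∑ i, ENNReal.ofReal (w i) • Measure.dirac (x i)) := by
  rw [integrable_finsetSum_measure]
  intro i _
  exact (integrable_dirac (by simp)).smul_measure ENNReal.ofReal_ne_top

lemma aux_integral {ι : Type} [Fintype ι] (w : ι → ℝ) (hw : ∀ i, 0 ≤ w i) (x : ι → Fin 3 → ℝ)
    {F : Type*} [NormedAddCommGroup F] [NormedSpace ℝ F] [CompleteSpace F]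
    (f : (Fin 3 → ℝ) → F) :
    ∫ r, f r ∂(∑ i, ENNReal.ofReal (w i) • Measure.dirac (x i)) = ∑ i, w i • f (x i) := by
  rw [integral_finsetSum_measure]
  · refine Finset.sum_congr rfl fun i _ => ?_
    rw [integral_smul_measure, integral_dirac, ENNReal.toReal_ofReal (hw i)]
  · intro i _
    exact (integrable_dirac (by simp)).smul_measure ENNReal.ofReal_ne_top

/-- The worst-case CVaR over the moment-based ambiguity set is attained: there is a Borel
probability measure `P` on ℝ³ with finite second moments, mean `μ` and covariance `S` whose
CVaR of the safety cost `l(r) = (r-μ)ᵀ E (r-μ) - 1` equals `-1 + (1/ε)·Tr(S·E)`. -/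
theorem worst_case_CVaR_attained (μ : Fin 3 → ℝ) (S E : Matrix (Fin 3) (Fin 3) ℝ)
    (hS : S.PosSemidef) (hE : E.PosDef) (ε : ℝ) (hε : ε ∈ Set.Ioo (0 : ℝ) 1) :
    ∃ P : Measure (Fin 3 → ℝ), IsProbabilityMeasure P ∧
      Integrable (fun r => ‖r‖ ^ 2) P ∧
      (∫ r, r ∂P) = μ ∧
      (∀ i j, S i j = ∫ r, (r i - μ i) * (r j - μ j) ∂P) ∧
      CVaR P (fun r => dotProduct (r - μ) (E.mulVec (r - μ)) - 1) ε =
        -1 + ε⁻¹ * (S * E).trace := by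
  obtain ⟨h0, h1⟩ := hε
  obtain ⟨B, hB⟩ := CStarAlgebra.nonneg_iff_eq_star_mul_self.mp hS.nonneg
  have hSB : ∀ i j, S i j = ∑ k, B k i * B k j := by
    intro i j
    rw [hB]
    simp [Matrix.mul_apply, Matrix.star_apply]
  obtain ⟨a, ha⟩ : ∃ a : ℝ, a * a = 3 / ε :=
    ⟨Real.sqrt (3 / ε), Real.mul_self_sqrt (by positivity)⟩
  let w : Option (Fin 3 ⊕ Fin 3) → ℝ := fun o => o.elim (1 - ε) (fun _ => ε / 6)
  let x : Option (Fin 3 ⊕ Fin 3) → Fin 3 → ℝ := fun o =>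
    o.elim μ (Sum.elim (fun k => μ + a • B k) (fun k => μ - a • B k))
  have hw : ∀ i, 0 ≤ w i := by
    rintro (_ | _)
    · simp only [w, Option.elim]; linarith
    · simp only [w, Option.elim]; positivity
  have hea : ε * (a * a) = 3 := by rw [ha]; field_simp
  refine ⟨∑ i, ENNReal.ofReal (w i) • Measure.dirac (x i), ⟨?_⟩, aux_integrable _ _ _, ?_, ?_, ?_⟩
  · have hs : ∑ i, w i = 1 := by
      simp [w, Fintype.sum_option]; ring
    simp only [Measure.coe_finset_sum, Finset.sum_apply, Measure.smul_apply, measure_univ,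
      smul_eq_mul, mul_one]
    rw [← ENNReal.ofReal_sum_of_nonneg (fun i _ => hw i), hs, ENNReal.ofReal_one]
  · rw [aux_integral w hw]
    ext i
    simp [w, x, Fintype.sum_option, Fin.sum_univ_three]
    ring
  · intro i j
    rw [aux_integral w hw, hSB]
    simp [w, x, Fintype.sum_option, Fin.sum_univ_three]
    linear_combination (-(1 / 3 : ℝ)) * (B 0 i * B 0 j + B 1 i * B 1 j + B 2 i * B 2 j) * hea
  · have hq : ∀ k, 0 ≤ B k ⬝ᵥ (E *ᵥ B k) := fun k => by
      simpa using hE.posSemidef.dotProduct_mulVec_nonneg (B k)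
    have htr : (S * E).trace = ∑ k, B k ⬝ᵥ (E *ᵥ B k) := by
      have hEs : ∀ i j, E i j = E j i := fun i j => by
        simpa using (hE.isHermitian.apply i j).symm
      simp only [Matrix.trace, Matrix.diag, Matrix.mul_apply, hSB, dotProduct, Matrix.mulVec,
        Fin.sum_univ_three]
      rw [hEs 1 0, hEs 2 0, hEs 2 1]
      ring
    have hval : ∀ β : ℝ, β + ε⁻¹ * ∫ r, max (((r - μ) ⬝ᵥ (E *ᵥ (r - μ)) - 1) - β) 0
        ∂(∑ i, ENNReal.ofReal (w i) • Measure.dirac (x i)) =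
        β + ε⁻¹ * ((1 - ε) * max (-1 - β) 0) +
          (1 / 3) * ∑ k, max (3 / ε * (B k ⬝ᵥ (E *ᵥ B k)) - 1 - β) 0 := by
      intro β
      rw [aux_integral w hw]
      have e1 : ∀ k, (μ + a • B k - μ) ⬝ᵥ (E *ᵥ (μ + a • B k - μ))
          = 3 / ε * (B k ⬝ᵥ (E *ᵥ B k)) := by
        intro k
        rw [add_sub_cancel_left, Matrix.mulVec_smul, smul_dotProduct, dotProduct_smul, ← ha]
        simp only [smul_eq_mul]; ring
      have e2 : ∀ k, (μ - a • B k - μ) ⬝ᵥ (E *ᵥ (μ - a • B k - μ))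
          = 3 / ε * (B k ⬝ᵥ (E *ᵥ B k)) := by
        intro k
        rw [sub_sub_cancel_left, Matrix.mulVec_neg, neg_dotProduct_neg,
          Matrix.mulVec_smul, smul_dotProduct, dotProduct_smul, ← ha]
        simp only [smul_eq_mul]; ring
      simp only [w, x, Fintype.sum_option, Fintype.sum_sum_type, Option.elim, Sum.elim_inl,
        Sum.elim_inr, e1, e2, sub_self, Matrix.mulVec_zero, dotProduct_zero, zero_sub,
        smul_eq_mul, ← Finset.mul_sum]
      field_simp
      ring
    have key : ∑ k, (3 / ε * (B k ⬝ᵥ (E *ᵥ B k))) = 3 * (ε⁻¹ * (S * E).trace) := by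
      rw [← Finset.mul_sum, htr]; ring
    unfold CVaR
    simp only [hval]
    have hlow : ∀ β : ℝ, -1 + ε⁻¹ * (S * E).trace ≤ β + ε⁻¹ * ((1 - ε) * max (-1 - β) 0) +
          (1 / 3) * ∑ k, max (3 / ε * (B k ⬝ᵥ (E *ᵥ B k)) - 1 - β) 0 := by
      intro β
      have p1 : 0 ≤ ε⁻¹ * ((1 - ε) * max (-1 - β) 0) :=
        mul_nonneg (by positivity) (mul_nonneg (by linarith) (le_max_right _ _))
      have p2 : ∑ k, (3 / ε * (B k ⬝ᵥ (E *ᵥ B k)) - 1 - β) ≤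
          ∑ k, max (3 / ε * (B k ⬝ᵥ (E *ᵥ B k)) - 1 - β) 0 :=
        Finset.sum_le_sum fun k _ => le_max_left _ _
      rw [Finset.sum_sub_distrib, Finset.sum_sub_distrib, key] at p2
      simp only [Finset.sum_const, Finset.card_univ, Fintype.card_fin, nsmul_eq_mul] at p2
      push_cast at p2
      linarith
    refine le_antisymm ?_ (le_ciInf hlow)
    refine (ciInf_le ⟨_, Set.forall_mem_range.mpr hlow⟩ (-1)).trans (le_of_eq ?_)
    have hm : ∀ k, max (3 / ε * (B k ⬝ᵥ (E *ᵥ B k)) - 1 - (-1)) 0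
        = 3 / ε * (B k ⬝ᵥ (E *ᵥ B k)) := fun k => by
      rw [max_eq_left]
      · ring
      · have := mul_nonneg (by positivity : 0 ≤ 3 / ε) (hq k)
        linarith
    simp only [hm, key]
    simp
end

section
/- Let X be an integrable real-valued random variable on a probability space with probability measure P and let ε ∈ (0,1). Then the infimum defining CVaR_ε^P(X) is attained at β = VaR_ε^P(X); that is, CVaR_ε^P(X) = VaR_ε^P(X) + (1/ε) E_P[max(X - VaR_ε^P(X), 0)]. -/
open MeasureTheory

/-- Value-at-Risk of a real random variable `X` under measure `P` at level `ε`. -/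
noncomputable def VaR {Ω : Type*} [MeasurableSpace Ω] (P : Measure Ω) (X : Ω → ℝ) (ε : ℝ) : ℝ :=
  sInf {γ : ℝ | P {ω | X ω > γ} ≤ ENNReal.ofReal ε}

/-- The infimum defining CVaR is attained at `β = VaR_ε^P(X)`:
`CVaR_ε^P(X) = VaR_ε^P(X) + (1/ε) E_P[max(X - VaR_ε^P(X), 0)]`. -/
theorem CVaR_eq_at_VaR {Ω : Type*} [MeasurableSpace Ω] (P : Measure Ω) [IsProbabilityMeasure P]
    (X : Ω → ℝ) (hX : Measurable X) (hXi : Integrable X P)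
    (ε : ℝ) (hε : ε ∈ Set.Ioo (0 : ℝ) 1) :
    CVaR P X ε = VaR P X ε + ε⁻¹ * ∫ ω, max (X ω - VaR P X ε) 0 ∂P := by
  obtain ⟨h0, h1⟩ := hε
  set F : ℝ → ℝ := fun γ => ProbabilityTheory.cdf (P.map X) γ with hF
  haveI : IsProbabilityMeasure (P.map X) := Measure.isProbabilityMeasure_map hX.aemeasurable
  have hreal : ∀ γ, P.real {ω | X ω > γ} = 1 - F γ := by
    intro γ
    have e : {ω | X ω > γ} = (X ⁻¹' Set.Iic γ)ᶜ := by ext ω; simp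
    rw [e, probReal_compl_eq_one_sub (hX measurableSet_Iic), hF]
    simp only [ProbabilityTheory.cdf_eq_real]
    rw [map_measureReal_apply hX measurableSet_Iic]
  have hS : {γ : ℝ | P {ω | X ω > γ} ≤ ENNReal.ofReal ε} = {γ | 1 - ε ≤ F γ} := by
    ext γ
    simp only [Set.mem_setOf_eq]
    rw [ENNReal.le_ofReal_iff_toReal_le (measure_ne_top _ _) h0.le]
    have := hreal γ
    rw [measureReal_def] at this
    rw [this]
    constructor <;> intro h <;> linarith
  have hmono : Monotone F := ProbabilityTheory.monotone_cdf _
  have hne : {γ | 1 - ε ≤ F γ}.Nonempty := by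
    have := (ProbabilityTheory.tendsto_cdf_atTop (P.map X)).eventually
      (lt_mem_nhds (show 1 - ε < 1 by linarith))
    obtain ⟨γ, h⟩ := this.exists
    exact ⟨γ, h.le⟩
  have hbd : BddBelow {γ | 1 - ε ≤ F γ} := by
    have := (ProbabilityTheory.tendsto_cdf_atBot (P.map X)).eventually
      (gt_mem_nhds (show 0 < 1 - ε by linarith))
    obtain ⟨γ, h⟩ := this.exists
    refine ⟨γ, fun x hx => ?_⟩
    by_contra hlt
    have h2 : F x ≤ F γ := hmono (not_le.mp hlt).le
    have h3 : F γ < 1 - ε := h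
    have h4 : 1 - ε ≤ F x := hx
    linarith
  have hint : ∀ β : ℝ, Integrable (fun ω => max (X ω - β) 0) P := fun β =>
    (hXi.sub (integrable_const β)).pos_part
  set I : ℝ → ℝ := fun β => ∫ ω, max (X ω - β) 0 ∂P with hI
  have hlip : LipschitzWith 1 I := by
    refine LipschitzWith.of_le_add fun x y => ?_
    have : I x ≤ ∫ ω, (max (X ω - y) 0 + dist x y) ∂P := by
      refine integral_mono (hint x) ((hint y).add (integrable_const _)) fun ω => ?_
      have h2 := abs_le.mp (Real.dist_eq x y).ge
      have h3 := le_max_left (X ω - y) 0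
      have h4 := le_max_right (X ω - y) 0
      exact max_le (by linarith [h2.1]) (add_nonneg h4 dist_nonneg)
    rw [integral_add (hint y) (integrable_const _)] at this
    simpa using this
  have hcont : Continuous fun β => β + ε⁻¹ * I β :=
    continuous_id.add (continuous_const.mul hlip.continuous)
  have hms : ∀ γ, MeasurableSet {ω | X ω > γ} := fun γ => hX measurableSet_Ioi
  -- the comparison of the two expectations
  have key : ∀ γ β, I γ + (γ - β) * (1 - F γ) ≤ I β := by
    intro γ β
    have hi : Integrable (Set.indicator {ω | X ω > γ} fun _ => γ - β) P :=
      (integrable_const _).indicator (hms γ)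
    have : ∫ ω, (max (X ω - γ) 0 + Set.indicator {ω | X ω > γ} (fun _ => γ - β) ω) ∂P ≤ I β := by
      refine integral_mono ((hint γ).add hi) (hint β) fun ω => ?_
      by_cases h : X ω > γ
      · simp only [Set.indicator, Set.mem_setOf_eq, h, if_true]
        rw [max_eq_left (by linarith)]
        exact le_trans (by linarith) (le_max_left _ _)
      · simp only [Set.indicator, Set.mem_setOf_eq, h, if_false]
        rw [max_eq_right (by linarith)]
        simp
    rw [integral_add (hint γ) hi, integral_indicator_const _ (hms γ), hreal, smul_eq_mul] at this
    linarith
  have hv : VaR P X ε = sInf {γ | 1 - ε ≤ F γ} := by rw [VaR, hS]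
  set v := VaR P X ε with hvdef
  have hcomp : ∀ γ β, (γ - β) * (ε - (1 - F γ)) ≤ 0 →
      γ + ε⁻¹ * I γ ≤ β + ε⁻¹ * I β := by
    intro γ β h
    have h2 : ε⁻¹ * (I γ + (γ - β) * ε) ≤ ε⁻¹ * I β :=
      mul_le_mul_of_nonneg_left (by linarith [key γ β]) (inv_nonneg.mpr h0.le)
    have h3 : ε⁻¹ * (I γ + (γ - β) * ε) = ε⁻¹ * I γ + (γ - β) := by
      field_simp
    linarith
  have hmin : ∀ β, v + ε⁻¹ * I v ≤ β + ε⁻¹ * I β := by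
    intro β
    have hcl : IsClosed {γ | γ + ε⁻¹ * I γ ≤ β + ε⁻¹ * I β} :=
      isClosed_le hcont continuous_const
    rcases lt_trichotomy v β with h | h | h
    · have hsub : Set.Ioo v β ⊆ {γ | γ + ε⁻¹ * I γ ≤ β + ε⁻¹ * I β} := by
        intro γ hγ
        obtain ⟨s, hs, hsγ⟩ := exists_lt_of_csInf_lt hne (hv ▸ hγ.1)
        have h5 : F s ≤ F γ := hmono hsγ.le
        have h6 : 1 - ε ≤ F s := hs
        exact hcomp γ β (mul_nonpos_of_nonpos_of_nonneg (by linarith [hγ.2]) (by linarith))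
      have := hcl.closure_subset_iff.mpr hsub
      rw [closure_Ioo h.ne] at this
      exact this ⟨le_rfl, h.le⟩
    · rw [h]
    · have hsub : Set.Ioo β v ⊆ {γ | γ + ε⁻¹ * I γ ≤ β + ε⁻¹ * I β} := by
        intro γ hγ
        have h6 : F γ < 1 - ε := by
          by_contra hc
          have : v ≤ γ := hv ▸ csInf_le hbd (not_lt.mp hc)
          linarith [hγ.2]
        exact hcomp γ β (mul_nonpos_of_nonneg_of_nonpos (by linarith [hγ.1]) (by linarith))
      have := hcl.closure_subset_iff.mpr hsub
      rw [closure_Ioo h.ne] at this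
      exact this ⟨h.le, le_rfl⟩
  refine le_antisymm ?_ (le_ciInf hmin)
  exact ciInf_le (f := fun β => β + ε⁻¹ * I β) ⟨_, by rintro _ ⟨β, rfl⟩; exact hmin β⟩ v
end

section
/- Let X be an integrable real-valued random variable on a probability space with probability measure P, let ε ∈ (0,1), and write v = VaR_ε^P(X). If P(X > v) = ε, then CVaR_ε^P(X) = (1/ε) E_P[X · 1{X > v}]; that is, CVaR equals the conditional expectation of X given that X exceeds its Value-at-Risk. -/
open MeasureTheory

/-- If `P(X > VaR_ε^P(X)) = ε`, then CVaR equals the conditional expectation of `X` above its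
Value-at-Risk: `CVaR_ε^P(X) = (1/ε) E_P[X · 1{X > VaR_ε^P(X)}]`. -/
theorem CVaR_eq_cond_exp {Ω : Type*} [MeasurableSpace Ω] (P : Measure Ω) [IsProbabilityMeasure P]
    (X : Ω → ℝ) (hX : Measurable X) (hXi : Integrable X P)
    (ε : ℝ) (hε : ε ∈ Set.Ioo (0 : ℝ) 1)
    (hv : P {ω | X ω > VaR P X ε} = ENNReal.ofReal ε) :
    CVaR P X ε = ε⁻¹ * ∫ ω in {ω | X ω > VaR P X ε}, X ω ∂P := by
  generalize VaR P X ε = v at hv ⊢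
  obtain ⟨h0, h1⟩ := hε
  have hA : MeasurableSet {ω | X ω > v} := measurableSet_lt measurable_const hX
  have hint : ∀ β : ℝ, Integrable (fun ω => X ω - β) P := fun β => hXi.sub (integrable_const β)
  have hmax : ∀ β : ℝ, Integrable (fun ω => max (X ω - β) 0) P := fun β => (hint β).pos_part
  have hreal : P.real {ω | X ω > v} = ε := by
    rw [Measure.real, hv, ENNReal.toReal_ofReal h0.le]
  have hset : ∀ β : ℝ, ∫ ω in {ω | X ω > v}, (X ω - β) ∂P
      = (∫ ω in {ω | X ω > v}, X ω ∂P) - ε * β := by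
    intro β
    rw [integral_sub hXi.integrableOn (integrable_const β), setIntegral_const, hreal, smul_eq_mul]
  have hlow : ∀ β : ℝ, ε⁻¹ * ∫ ω in {ω | X ω > v}, X ω ∂P
      ≤ β + ε⁻¹ * ∫ ω, max (X ω - β) 0 ∂P := by
    intro β
    have h2 : ∫ ω in {ω | X ω > v}, (X ω - β) ∂P ≤ ∫ ω, max (X ω - β) 0 ∂P :=
      (integral_mono (hint β).integrableOn (hmax β).integrableOn
        (fun ω => le_max_left _ _)).trans
        (setIntegral_le_integral (hmax β) (Filter.Eventually.of_forall fun ω => le_max_right _ _))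
    rw [hset] at h2
    have h3 := mul_le_mul_of_nonneg_left h2 (inv_pos.mpr h0).le
    rw [mul_sub, inv_mul_cancel_left₀ h0.ne'] at h3
    linarith
  have heq : v + ε⁻¹ * ∫ ω, max (X ω - v) 0 ∂P = ε⁻¹ * ∫ ω in {ω | X ω > v}, X ω ∂P := by
    have h2 : ∫ ω, max (X ω - v) 0 ∂P = ∫ ω in {ω | X ω > v}, (X ω - v) ∂P := by
      rw [← integral_indicator hA]
      congr 1
      ext ω
      by_cases h : X ω > v
      · rw [Set.indicator_of_mem (by exact h), max_eq_left (by linarith)]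
      · rw [Set.indicator_of_notMem (by exact h), max_eq_right (by linarith)]
    rw [h2, hset, mul_sub, inv_mul_cancel_left₀ h0.ne']
    ring
  unfold CVaR
  apply le_antisymm
  · rw [← heq]
    exact ciInf_le ⟨_, by rintro _ ⟨β, rfl⟩; exact hlow β⟩ v
  · exact le_ciInf hlow
end
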